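/- arXiv:1810.10212 — 7 statements merged into one kernel-verified Lean document; each statement's English description precedes it below -/
import Mathlib

section
/- For every θ ∈ [0, π] one has π/4 ≤ F(θ) ≤ π; moreover F(π/4) = π/4 and F(π) = π, so both bounds are attained. -/
open Real Set

lemma sin_mul_cos_lt_self {x : ℝ} (hx : 0 < x) : sin x * cos x < x := by
  have h := sin_lt (show 0 < 2 * x by linarith)
  rw [sin_two_mul] at h
  linarith

lemma four_div_pi_mul_le_sqrt_two_mul_sin {u : ℝ} (h0 : 0 ≤ u) (h1 : u ≤ π / 4) :
    4 / π * u ≤ √2 * sin u := by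
  have hpi := pi_pos
  have hle : 4 / π * u ≤ 1 := by
    calc 4 / π * u ≤ 4 / π * (π / 4) := by gcongr
      _ = 1 := by field_simp
  have hc := strictConcaveOn_sin_Icc.concaveOn.2
    (show (0 : ℝ) ∈ Icc 0 π from ⟨le_rfl, hpi.le⟩)
    (show π / 4 ∈ Icc 0 π from ⟨by linarith, by linarith⟩)
    (sub_nonneg.2 hle) (show 0 ≤ 4 / π * u by positivity) (by ring)
  have harg : 4 / π * u * (π / 4) = u := by field_simp
  simp only [smul_eq_mul, sin_zero, mul_zero, zero_add, harg, sin_pi_div_four] at hc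
  have hs : √2 * √2 = 2 := mul_self_sqrt (by norm_num)
  calc 4 / π * u = √2 * (4 / π * u * (√2 / 2)) := by linear_combination (-(4 / π * u / 2)) * hs
    _ ≤ √2 * sin u := by gcongr

lemma one_add_pi_div_eight_le {u : ℝ} (hu : |u| ≤ π / 4) :
    1 + π / 8 ≤ √2 * cos u + 2 / π * u ^ 2 := by
  have hpi := pi_pos
  have hanti : AntitoneOn (fun u : ℝ => √2 * cos u + 2 / π * u ^ 2) (Icc 0 (π / 4)) := by
    have hd (v : ℝ) : HasDerivAt (fun u : ℝ => √2 * cos u + 2 / π * u ^ 2)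
        (√2 * (-sin v) + 2 / π * (2 * v)) v := by
      simpa using! ((hasDerivAt_cos v).const_mul √2).add ((hasDerivAt_pow 2 v).const_mul (2 / π))
    refine antitoneOn_of_deriv_nonpos (convex_Icc _ _) (by fun_prop)
      (fun v _ => (hd v).differentiableAt.differentiableWithinAt) fun v hv => ?_
    rw [interior_Icc] at hv
    rw [(hd v).deriv]
    have := four_div_pi_mul_le_sqrt_two_mul_sin hv.1.le hv.2.le
    have h : 2 / π * (2 * v) = 4 / π * v := by ring
    linarith
  have h := hanti ⟨abs_nonneg u, hu⟩ ⟨by positivity, le_rfl⟩ hu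
  simp only [cos_abs, sq_abs, cos_pi_div_four] at h
  have hs : √2 * (√2 / 2) = 1 := by linarith [mul_self_sqrt (show (0 : ℝ) ≤ 2 by norm_num)]
  have hq : 2 / π * (π / 4) ^ 2 = π / 8 := by field_simp; norm_num
  linarith

lemma pi_div_four_mul_le_sq {θ : ℝ} (h0 : 0 ≤ θ) :
    π / 4 * (θ + sin θ * (sin θ - cos θ)) ≤ θ ^ 2 := by
  have hpi := pi_pos
  have hs : √2 * √2 = 2 := mul_self_sqrt (by norm_num)
  rcases le_total θ (π / 4) with h | h
  · have hk := one_add_pi_div_eight_le (u := 2 * θ - π / 4)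
      (abs_le.2 ⟨by linarith, by linarith⟩)
    rw [cos_sub, cos_pi_div_four, sin_pi_div_four, sin_two_mul, cos_two_mul] at hk
    have hm := mul_le_mul_of_nonneg_left hk (show 0 ≤ π / 8 by positivity)
    have hq : π / 8 * (2 / π * (2 * θ - π / 4) ^ 2) = (2 * θ - π / 4) ^ 2 / 4 := by
      field_simp; norm_num
    have hc : √2 * ((2 * cos θ ^ 2 - 1) * (√2 / 2) + 2 * sin θ * cos θ * (√2 / 2))
        = 2 * cos θ ^ 2 - 1 + 2 * sin θ * cos θ := by
      linear_combination ((2 * cos θ ^ 2 - 1 + 2 * sin θ * cos θ) / 2) * hs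
    rw [hc, mul_add _ _ (2 / π * _), hq] at hm
    have hsq : sin θ ^ 2 = 1 - cos θ ^ 2 := sin_sq θ
    linear_combination hm + π / 4 * hsq
  · obtain ⟨x, rfl⟩ : ∃ x, θ = x + π / 4 := ⟨θ - π / 4, by ring⟩
    have hx : 0 ≤ x := by linarith
    have hsc : sin x * cos x ≤ x := by
      rcases hx.eq_or_lt with rfl | hx
      · simp
      · exact (sin_mul_cos_lt_self hx).le
    have hss : sin x ^ 2 ≤ x ^ 2 := sin_sq_le_sq
    have he : sin (x + π / 4) * (sin (x + π / 4) - cos (x + π / 4))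
        = sin x ^ 2 + sin x * cos x := by
      rw [sin_add, cos_add, cos_pi_div_four, sin_pi_div_four]
      linear_combination ((sin x ^ 2 + sin x * cos x) / 2) * hs
    rw [he]
    nlinarith [mul_le_mul_of_nonneg_left hsc hpi.le, pi_le_four, sq_nonneg x,
      mul_le_mul_of_nonneg_left hss hpi.le]

lemma sq_le_pi_mul {θ : ℝ} (h0 : 0 < θ) (h1 : θ ≤ π) :
    θ ^ 2 ≤ π * (θ + sin θ * (sin θ - cos θ)) := by
  have hpi := pi_pos
  have hsin := sin_nonneg_of_nonneg_of_le_pi h0.le h1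
  rcases le_total θ (π / 2) with h | h
  · have hj := mul_le_sin h0.le h
    have hsc := mul_le_mul_of_nonneg_left (sin_mul_cos_lt_self h0).le hpi.le
    have hsq : (2 / π * θ) ^ 2 ≤ sin θ ^ 2 := by gcongr
    have hm := mul_le_mul_of_nonneg_left hsq hpi.le
    have he : π * (2 / π * θ) ^ 2 = 4 / π * θ ^ 2 := by field_simp; norm_num
    have h4 : 1 ≤ 4 / π := by rw [le_div_iff₀ hpi]; linarith [pi_le_four]
    nlinarith [mul_le_mul_of_nonneg_right h4 (sq_nonneg θ)]
  · have hcos := cos_nonpos_of_pi_div_two_le_of_le h (by linarith)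
    have hp : 0 ≤ sin θ * (sin θ - cos θ) := mul_nonneg hsin (by linarith)
    nlinarith [mul_nonneg hpi.le hp]

/-- Define `F : [0, π] → ℝ` by `F 0 = 1` and
`F θ = θ² / (θ + sin θ * (sin θ - cos θ))` for `θ ∈ (0, π]`.
Then `π/4 ≤ F θ ≤ π` for every `θ ∈ [0, π]`, and moreover
`F (π/4) = π/4` and `F π = π`, so both bounds are attained. -/
theorem stmt_0 (F : ℝ → ℝ) (hF0 : F 0 = 1)
    (hF : ∀ θ ∈ Set.Ioc (0 : ℝ) π,
      F θ = θ ^ 2 / (θ + Real.sin θ * (Real.sin θ - Real.cos θ))) :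
    (∀ θ ∈ Set.Icc (0 : ℝ) π, π / 4 ≤ F θ ∧ F θ ≤ π) ∧
      F (π / 4) = π / 4 ∧ F π = π := by
  have hpi := pi_pos
  refine ⟨fun θ hθ => ?_, ?_, ?_⟩
  · rcases hθ.1.eq_or_lt with rfl | h0
    · rw [hF0]
      exact ⟨by linarith [pi_le_four], by linarith [pi_gt_three]⟩
    · have hG : 0 < θ + sin θ * (sin θ - cos θ) := by
        nlinarith [sin_mul_cos_lt_self h0, sq_nonneg (sin θ)]
      rw [hF θ ⟨h0, hθ.2⟩, le_div_iff₀ hG, div_le_iff₀ hG]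
      exact ⟨pi_div_four_mul_le_sq h0.le, sq_le_pi_mul h0 hθ.2⟩
  · rw [hF _ ⟨by linarith, by linarith⟩, sin_pi_div_four, cos_pi_div_four]
    field_simp
    simp
  · rw [hF _ ⟨hpi, le_rfl⟩, sin_pi, cos_pi]
    field_simp
    simp
end

section
/- The function F is monotone decreasing on the interval [0, π/4]. -/
open Real Set

lemma sin_le_cos_of_mem_Icc {x : ℝ} (hx : x ∈ Set.Icc 0 (π / 4)) : Real.sin x ≤ Real.cos x := by
  rw [← Real.sin_pi_div_two_sub]
  exact Real.sin_le_sin_of_le_of_le_pi_div_two (by linarith [hx.1, Real.pi_pos])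
    (by linarith [hx.1]) (by linarith [hx.2])

lemma mul_cos_le_sin {x : ℝ} (h0 : 0 ≤ x) (h1 : x < π / 2) : x * Real.cos x ≤ Real.sin x := by
  have hc : 0 < Real.cos x := Real.cos_pos_of_mem_Ioo ⟨by linarith [Real.pi_pos], h1⟩
  have h := Real.le_tan h0 h1
  rwa [Real.tan_eq_sin_div_cos, le_div_iff₀ hc] at h

lemma hasDerivAt_add_sin_mul_sin_sub_cos (x : ℝ) :
    HasDerivAt (fun θ : ℝ => θ + Real.sin θ * (Real.sin θ - Real.cos θ))
      (2 * Real.sin x * (Real.sin x + Real.cos x)) x := by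
  refine ((hasDerivAt_id' x).fun_add ((Real.hasDerivAt_sin x).fun_mul
    ((Real.hasDerivAt_sin x).fun_sub (Real.hasDerivAt_cos x)))).congr_deriv ?_
  linear_combination -Real.sin_sq_add_cos_sq x

lemma sq_le_add_sin_mul_sin_sub_cos {x : ℝ} (hx : x ∈ Set.Icc 0 (π / 4)) :
    x ^ 2 ≤ x + Real.sin x * (Real.sin x - Real.cos x) := by
  have hd (y : ℝ) := (hasDerivAt_add_sin_mul_sin_sub_cos y).sub (hasDerivAt_pow 2 y)
  have hmono : MonotoneOn ((fun θ : ℝ => θ + Real.sin θ * (Real.sin θ - Real.cos θ)) -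
      fun θ : ℝ => θ ^ 2) (Set.Icc 0 (π / 4)) := by
    refine monotoneOn_of_deriv_nonneg (convex_Icc _ _)
      (fun y _ => (hd y).continuousAt.continuousWithinAt)
      (fun y _ => (hd y).differentiableAt.differentiableWithinAt) fun y hy => ?_
    rw [(hd y).deriv]
    replace hy := interior_subset hy
    have hsc := sin_le_cos_of_mem_Icc hy
    have hlt : y < π / 2 := by linarith [hy.2, Real.pi_pos]
    have hs : 0 ≤ Real.sin y :=
      Real.sin_nonneg_of_nonneg_of_le_pi hy.1 (by linarith [Real.pi_pos])
    have hc : 0 < Real.cos y := Real.cos_pos_of_mem_Ioo ⟨by linarith [hy.1, Real.pi_pos], hlt⟩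
    have hyc := mul_cos_le_sin hy.1 hlt
    have key : y ≤ Real.sin y * (Real.sin y + Real.cos y) := by
      refine le_of_mul_le_mul_right (hyc.trans ?_) hc
      nlinarith [mul_nonneg (mul_nonneg hs hs) (sub_nonneg.2 hsc), Real.sin_sq_add_cos_sq y]
    norm_num
    linarith
  have h := hmono ⟨le_rfl, hx.1.trans hx.2⟩ hx hx.1
  simp at h
  linarith

lemma antitoneOn_sq_div_add_sin_mul_sin_sub_cos :
    AntitoneOn (fun θ : ℝ => θ ^ 2 / (θ + Real.sin θ * (Real.sin θ - Real.cos θ)))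
      (Set.Ioc 0 (π / 4)) := by
  have hpos {y : ℝ} (hy : y ∈ Set.Ioc 0 (π / 4)) :
      0 < y + Real.sin y * (Real.sin y - Real.cos y) :=
    (pow_pos hy.1 2).trans_le (sq_le_add_sin_mul_sin_sub_cos (Ioc_subset_Icc_self hy))
  have hd {y : ℝ} (hy : y ∈ Set.Ioc 0 (π / 4)) :=
    (hasDerivAt_pow 2 y).fun_div (hasDerivAt_add_sin_mul_sin_sub_cos y) (hpos hy).ne'
  refine antitoneOn_of_deriv_nonpos (convex_Ioc _ _)
    (fun y hy => (hd hy).continuousAt.continuousWithinAt)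
    (fun y hy => (hd (interior_subset hy)).differentiableAt.differentiableWithinAt)
    fun y hy => ?_
  replace hy := interior_subset hy
  rw [(hd hy).deriv]
  refine div_nonpos_of_nonpos_of_nonneg ?_ (sq_nonneg _)
  have hsc := sin_le_cos_of_mem_Icc (Ioc_subset_Icc_self hy)
  have hyc := mul_cos_le_sin hy.1.le (by linarith [hy.2, Real.pi_pos])
  have h := mul_nonneg hy.1.le (mul_nonneg (sub_nonneg.2 hsc) (sub_nonneg.2 hyc))
  norm_num
  linear_combination 2 * h - 2 * y ^ 2 * Real.sin_sq_add_cos_sq y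

/-- Define `F : [0, π] → ℝ` by `F 0 = 1` and
`F θ = θ² / (θ + sin θ * (sin θ - cos θ))` for `θ ∈ (0, π]`.
Then `F` is monotone decreasing on `[0, π/4]`. -/
theorem stmt_1 (F : ℝ → ℝ) (hF0 : F 0 = 1)
    (hF : ∀ θ ∈ Set.Ioc (0 : ℝ) π,
      F θ = θ ^ 2 / (θ + Real.sin θ * (Real.sin θ - Real.cos θ))) :
    AntitoneOn F (Set.Icc 0 (π / 4)) := by
  intro a ha b hb hab
  have hpi := Real.pi_pos
  rcases hb.1.eq_or_lt with rfl | hb0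
  · rw [le_antisymm hab ha.1]
  rw [hF b ⟨hb0, by linarith [hb.2]⟩]
  rcases ha.1.eq_or_lt with rfl | ha0
  · rw [hF0]
    have h := sq_le_add_sin_mul_sin_sub_cos hb
    exact div_le_one_of_le₀ h ((sq_nonneg b).trans h)
  · rw [hF a ⟨ha0, by linarith [ha.2]⟩]
    exact antitoneOn_sq_div_add_sin_mul_sin_sub_cos ⟨ha0, ha.2⟩ ⟨hb0, hb.2⟩ hab
end

section
/- One has ψ(θ) ≤ 0 for every θ ∈ [0, π/4] and ψ(θ) ≥ 0 for every θ ∈ [π/4, π]; in particular ψ(π/4) = 0. -/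
open Real Set

lemma mul_cos_le_sin_of_mem_Icc {θ : ℝ} (hθ : θ ∈ Icc (0 : ℝ) π) : θ * cos θ ≤ sin θ := by
  have hs := sin_nonneg_of_mem_Icc hθ
  rcases lt_or_ge θ (π / 2) with h | h
  · have hc : 0 < cos θ := cos_pos_of_mem_Ioo ⟨by linarith [hθ.1, pi_pos], h⟩
    have ht := le_tan hθ.1 h
    rwa [tan_eq_sin_div_cos, le_div_iff₀ hc] at ht
  · have hc : cos θ ≤ 0 := cos_nonpos_of_pi_div_two_le_of_le h (by linarith [hθ.2, pi_pos])
    linarith [mul_nonpos_of_nonneg_of_nonpos hθ.1 hc]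

lemma sin_le_cos_of_mem_Icc_s3 {θ : ℝ} (hθ : θ ∈ Icc (0 : ℝ) (π / 4)) : sin θ ≤ cos θ := by
  obtain ⟨h0, h1⟩ := hθ
  rw [← sin_pi_div_two_sub]
  exact sin_le_sin_of_le_of_le_pi_div_two (by linarith) (by linarith) (by linarith)

lemma cos_le_sin_of_mem_Icc {θ : ℝ} (hθ : θ ∈ Icc (π / 4) π) : cos θ ≤ sin θ := by
  obtain ⟨h0, h1⟩ := hθ
  have hp := pi_pos
  rw [← cos_pi_div_two_sub, ← cos_abs (π / 2 - θ)]
  exact cos_le_cos_of_nonneg_of_le_pi (abs_nonneg _) h1 (abs_le.2 ⟨by linarith, by linarith⟩)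

/-- Define `ψ : ℝ → ℝ` by
`ψ θ = θ * (1 - sin θ * (sin θ + cos θ)) + (2 sin θ - θ cos θ) * (sin θ - cos θ)`.
Then `ψ θ ≤ 0` for every `θ ∈ [0, π/4]` and `ψ θ ≥ 0` for every `θ ∈ [π/4, π]`;
in particular `ψ (π/4) = 0`. -/
theorem stmt_3 (ψ : ℝ → ℝ)
    (hψ : ∀ θ : ℝ, ψ θ = θ * (1 - Real.sin θ * (Real.sin θ + Real.cos θ)) +
      (2 * Real.sin θ - θ * Real.cos θ) * (Real.sin θ - Real.cos θ)) :
    (∀ θ ∈ Set.Icc (0 : ℝ) (π / 4), ψ θ ≤ 0) ∧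
      (∀ θ ∈ Set.Icc (π / 4) π, 0 ≤ ψ θ) ∧
      ψ (π / 4) = 0 := by
  have hfac : ∀ θ, ψ θ = 2 * (sin θ - cos θ) * (sin θ - θ * cos θ) := fun θ => by
    rw [hψ]
    linear_combination -θ * sin_sq_add_cos_sq θ
  have hp := pi_pos
  refine ⟨fun θ hθ => ?_, fun θ hθ => ?_, ?_⟩
  · have h := mul_cos_le_sin_of_mem_Icc ⟨hθ.1, by linarith [hθ.2]⟩
    rw [hfac]
    exact mul_nonpos_of_nonpos_of_nonneg (by linarith [sin_le_cos_of_mem_Icc_s3 hθ])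
      (by linarith)
  · have h := mul_cos_le_sin_of_mem_Icc ⟨by linarith [hθ.1], hθ.2⟩
    rw [hfac]
    exact mul_nonneg (by linarith [cos_le_sin_of_mem_Icc hθ]) (by linarith)
  · rw [hfac, sin_pi_div_four, cos_pi_div_four]
    ring
end

section
/- For every θ ∈ [0, π/4] one has 1 + (1 − 2θ)·cos 2θ + (1 + 2θ)·sin 2θ ≥ 2 − π/2. -/
open Real Set

/-- For every `θ ∈ [0, π/4]`, `1 + (1 - 2θ) * cos 2θ + (1 + 2θ) * sin 2θ ≥ 2 - π/2`. -/
theorem stmt_5 :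
    ∀ θ ∈ Set.Icc (0 : ℝ) (π / 4),
      2 - π / 2 ≤ 1 + (1 - 2 * θ) * Real.cos (2 * θ) + (1 + 2 * θ) * Real.sin (2 * θ) := by
  rintro θ ⟨h0, h1⟩
  have hs : 0 ≤ sin (2 * θ) := sin_nonneg_of_nonneg_of_le_pi (by linarith) (by linarith [pi_pos])
  have hc : 0 ≤ cos (2 * θ) := cos_nonneg_of_neg_pi_div_two_le_of_le (by linarith) (by linarith)
  have hsum : 1 ≤ cos (2 * θ) + sin (2 * θ) := by
    nlinarith [sin_sq_add_cos_sq (2 * θ), mul_nonneg hs hc]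
  have hdiff : 0 ≤ 2 * θ * (sin (2 * θ) - cos (2 * θ) + 1) :=
    mul_nonneg (by linarith) (by linarith [cos_le_one (2 * θ)])
  linarith
end

section
/- For every θ ∈ [3π/4, π] one has 1 + (1 − 2θ)·cos 2θ + (1 + 2θ)·sin 2θ ≤ 2·(1 − θ), and in particular this quantity is ≤ 0 on [3π/4, π]. -/
open Real Set

/-- For every `θ ∈ [3π/4, π]`, one has
`1 + (1 - 2θ) * cos 2θ + (1 + 2θ) * sin 2θ ≤ 2 * (1 - θ)`, and in particular
this quantity is `≤ 0` on `[3π/4, π]`. -/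
theorem stmt_7 :
    ∀ θ ∈ Set.Icc (3 * π / 4) π,
      1 + (1 - 2 * θ) * Real.cos (2 * θ) + (1 + 2 * θ) * Real.sin (2 * θ) ≤ 2 * (1 - θ) ∧
      1 + (1 - 2 * θ) * Real.cos (2 * θ) + (1 + 2 * θ) * Real.sin (2 * θ) ≤ 0 := by
  rintro θ ⟨hl, hu⟩
  have hpi := Real.pi_gt_three
  have hc : 0 ≤ Real.cos (2 * θ) := by
    rw [← Real.cos_two_pi_sub]
    exact Real.cos_nonneg_of_mem_Icc ⟨by linarith, by linarith⟩
  have hs : Real.sin (2 * θ) ≤ 0 := by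
    have h : 0 ≤ Real.sin (2 * π - 2 * θ) :=
      Real.sin_nonneg_of_nonneg_of_le_pi (by linarith) (by linarith)
    rw [Real.sin_two_pi_sub] at h
    linarith
  have hc1 := Real.cos_le_one (2 * θ)
  have hcs : 1 ≤ Real.cos (2 * θ) - Real.sin (2 * θ) := by
    nlinarith [Real.sin_sq_add_cos_sq (2 * θ), mul_nonneg hc (neg_nonneg.2 hs)]
  have hθ : 0 ≤ θ := by linarith
  have key : 1 + (1 - 2 * θ) * Real.cos (2 * θ) + (1 + 2 * θ) * Real.sin (2 * θ)
      ≤ 2 * (1 - θ) := by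
    linarith [mul_nonneg hθ (sub_nonneg.2 hcs)]
  exact ⟨key, by linarith⟩
end

section
/- The function ν is strictly increasing on (0, π), tends to 0 as θ → 0⁺ and tends to +∞ as θ → π⁻; consequently, for every real r > 0 there exists a unique θ ∈ (0, π) with ν(θ) = r. -/
open Real Set Filter

lemma mul_cos_lt_sin {x : ℝ} (h0 : 0 < x) (hπ : x < π) : x * cos x < sin x := by
  have hs : 0 < sin x := sin_pos_of_pos_of_lt_pi h0 hπ
  rcases lt_or_ge x (π / 2) with h | h
  · have hc : 0 < cos x := cos_pos_of_mem_Ioo ⟨by linarith, h⟩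
    have ht := lt_tan h0 h
    rwa [tan_eq_sin_div_cos, lt_div_iff₀ hc] at ht
  · have hc : cos x ≤ 0 := cos_nonpos_of_pi_div_two_le_of_le h (by linarith)
    nlinarith

lemma hasDerivAt_sub_sin_mul_cos_div_sin_sq {x : ℝ} (hx : sin x ≠ 0) :
    HasDerivAt (fun θ : ℝ => (θ - sin θ * cos θ) / sin θ ^ 2)
      (2 * (sin x - x * cos x) / sin x ^ 3) x := by
  have h := ((hasDerivAt_id x).sub ((hasDerivAt_sin x).mul (hasDerivAt_cos x))).div
    ((hasDerivAt_sin x).pow 2) (pow_ne_zero 2 hx)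
  refine h.congr_deriv ?_
  simp only [Pi.sub_apply, Pi.mul_apply, Pi.pow_apply, id_eq]
  field_simp
  have hc : cos x ^ 2 = 1 - sin x ^ 2 := cos_sq' x
  push_cast
  linear_combination sin x ^ 2 * hc

lemma continuousOn_sub_sin_mul_cos_div_sin_sq :
    ContinuousOn (fun θ : ℝ => (θ - sin θ * cos θ) / sin θ ^ 2) (Ioo 0 π) := fun _ hx =>
  (hasDerivAt_sub_sin_mul_cos_div_sin_sq
    (sin_pos_of_mem_Ioo hx).ne').continuousAt.continuousWithinAt

lemma strictMonoOn_sub_sin_mul_cos_div_sin_sq :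
    StrictMonoOn (fun θ : ℝ => (θ - sin θ * cos θ) / sin θ ^ 2) (Ioo 0 π) := by
  refine strictMonoOn_of_deriv_pos (convex_Ioo 0 π)
    continuousOn_sub_sin_mul_cos_div_sin_sq fun x hx => ?_
  rw [interior_Ioo] at hx
  have hs := sin_pos_of_mem_Ioo hx
  rw [(hasDerivAt_sub_sin_mul_cos_div_sin_sq hs.ne').deriv]
  have := sub_pos.2 (mul_cos_lt_sin hx.1 hx.2)
  positivity

lemma sub_sin_mul_cos_div_sin_sq_nonneg {x : ℝ} (hx : x ∈ Ioo 0 π) :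
    0 ≤ (x - sin x * cos x) / sin x ^ 2 := by
  refine div_nonneg ?_ (sq_nonneg _)
  nlinarith [sin_pos_of_mem_Ioo hx, sin_lt hx.1, cos_le_one x]

lemma sub_sin_mul_cos_div_sin_sq_le {x : ℝ} (h0 : 0 < x) (h1 : x < 1) :
    (x - sin x * cos x) / sin x ^ 2 ≤ 4 / 3 * x := by
  have hs : x - x ^ 3 / 4 < sin x := by linarith [sin_gt_sub_cube h0, pow_pos h0 3]
  have hc : 1 - x ^ 2 / 2 ≤ cos x := one_sub_sq_div_two_le_cos
  have hx2 : x ^ 2 < 1 := by nlinarith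
  have hs' : 3 / 4 * x ≤ sin x := by nlinarith
  have hsc : (x - x ^ 3 / 4) * (1 - x ^ 2 / 2) ≤ sin x * cos x :=
    mul_le_mul hs.le hc (by linarith) (by linarith)
  have hsq : (3 / 4 * x) ^ 2 ≤ sin x ^ 2 := by gcongr
  rw [div_le_iff₀ (by nlinarith)]
  have h5 : 0 < x ^ 5 := by positivity
  nlinarith [mul_le_mul_of_nonneg_left hsq h0.le]

lemma tendsto_sub_sin_mul_cos_div_sin_sq_zero :
    Tendsto (fun θ : ℝ => (θ - sin θ * cos θ) / sin θ ^ 2) (nhdsWithin 0 (Ioi 0)) (nhds 0) := by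
  have hmem : Ioo (0 : ℝ) 1 ∈ nhdsWithin 0 (Ioi 0) := Ioo_mem_nhdsGT one_pos
  have hlim : Tendsto (fun x : ℝ => 4 / 3 * x) (nhdsWithin 0 (Ioi 0)) (nhds 0) := by
    have h : Continuous fun x : ℝ => 4 / 3 * x := by fun_prop
    simpa using (h.tendsto 0).mono_left nhdsWithin_le_nhds
  refine tendsto_of_tendsto_of_tendsto_of_le_of_le' tendsto_const_nhds hlim ?_ ?_
  · filter_upwards [hmem] with x hx
    exact sub_sin_mul_cos_div_sin_sq_nonneg ⟨hx.1, by linarith [hx.2, pi_gt_three]⟩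
  · filter_upwards [hmem] with x hx
    exact sub_sin_mul_cos_div_sin_sq_le hx.1 hx.2

lemma tendsto_sub_sin_mul_cos_div_sin_sq_pi :
    Tendsto (fun θ : ℝ => (θ - sin θ * cos θ) / sin θ ^ 2) (nhdsWithin π (Iio π)) atTop := by
  have hnum : Tendsto (fun θ : ℝ => θ - sin θ * cos θ) (nhdsWithin π (Iio π)) (nhds π) := by
    have h : Continuous fun θ : ℝ => θ - sin θ * cos θ := by fun_prop
    simpa using (h.tendsto π).mono_left nhdsWithin_le_nhds
  have hden : Tendsto (fun θ : ℝ => sin θ ^ 2) (nhdsWithin π (Iio π))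
      (nhdsWithin 0 (Ioi 0)) := by
    refine tendsto_nhdsWithin_iff.2 ⟨?_, ?_⟩
    · have h : Continuous fun θ : ℝ => sin θ ^ 2 := by fun_prop
      simpa using (h.tendsto π).mono_left nhdsWithin_le_nhds
    · filter_upwards [Ioo_mem_nhdsLT pi_pos] with x hx
      exact pow_pos (sin_pos_of_mem_Ioo hx) 2
  simp only [div_eq_mul_inv]
  exact hnum.pos_mul_atTop pi_pos hden.inv_tendsto_nhdsGT_zero

/-- Define `ν : (0, π) → ℝ` by `ν θ = (θ - sin θ * cos θ) / sin² θ`. Then `ν` is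
strictly increasing on `(0, π)`, tends to `0` as `θ → 0⁺`, tends to `+∞` as
`θ → π⁻`; consequently, for every real `r > 0` there is a unique `θ ∈ (0, π)`
with `ν θ = r`. -/
theorem stmt_9 (ν : ℝ → ℝ)
    (hν : ∀ θ ∈ Set.Ioo (0 : ℝ) π,
      ν θ = (θ - Real.sin θ * Real.cos θ) / Real.sin θ ^ 2) :
    StrictMonoOn ν (Set.Ioo 0 π) ∧
      Tendsto ν (nhdsWithin 0 (Set.Ioi 0)) (nhds 0) ∧
      Tendsto ν (nhdsWithin π (Set.Iio π)) atTop ∧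
      ∀ r : ℝ, 0 < r → ∃! θ : ℝ, θ ∈ Set.Ioo (0 : ℝ) π ∧ ν θ = r := by
  have heq : EqOn (fun θ : ℝ => (θ - sin θ * cos θ) / sin θ ^ 2) ν (Ioo 0 π) :=
    fun θ hθ => (hν θ hθ).symm
  have hmono : StrictMonoOn ν (Ioo 0 π) := strictMonoOn_sub_sin_mul_cos_div_sin_sq.congr heq
  have hcont : ContinuousOn ν (Ioo 0 π) :=
    continuousOn_sub_sin_mul_cos_div_sin_sq.congr heq.symm
  have hzero_mem : Ioo 0 π ∈ nhdsWithin 0 (Ioi 0) := Ioo_mem_nhdsGT pi_pos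
  have hpi_mem : Ioo 0 π ∈ nhdsWithin π (Iio π) := Ioo_mem_nhdsLT pi_pos
  have hzero : Tendsto ν (nhdsWithin 0 (Ioi 0)) (nhds 0) :=
    tendsto_sub_sin_mul_cos_div_sin_sq_zero.congr' (heq.eventuallyEq_of_mem hzero_mem)
  have hpi : Tendsto ν (nhdsWithin π (Iio π)) atTop :=
    tendsto_sub_sin_mul_cos_div_sin_sq_pi.congr' (heq.eventuallyEq_of_mem hpi_mem)
  refine ⟨hmono, hzero, hpi, fun r hr => ?_⟩
  obtain ⟨θ, hθ, rfl⟩ := isPreconnected_Ioo.intermediate_value_Ioi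
    (le_principal_iff.2 hzero_mem) (le_principal_iff.2 hpi_mem) hcont hzero hpi hr
  exact ⟨θ, ⟨hθ, rfl⟩, fun y hy => hmono.injOn hy.1 hθ hy.2⟩
end

section
/- There exists a finite nonnegative Borel measure ν on (0, ∞) such that ∫₀^∞ τ⁻¹ dν(τ) < ∞ and, for every u > 0, φ(u) = ∫₀^∞ exp(−π·τ²·u²) dν(τ); that is, φ is an average of Gaussians. -/
open Real Set MeasureTheory
open Filter Topology

/-- `f` agrees on `(0, ∞)` with the moment function `s ↦ ∫ tˢ dμ(t)` of a probability measure `μ`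
on `[0, 1]`, where mass at `0` contributes nothing. Via `t = e⁻ʳ` these are the Laplace transforms
of probability measures on `[0, ∞]`. -/
def IsMomentFunction (f : ℝ → ℝ) : Prop :=
  ∃ μ : ProbabilityMeasure unitInterval,
    ∀ s : ℝ, 0 < s → f s = ∫ t, (t : ℝ) ^ s ∂(μ : Measure unitInterval)

theorem continuous_unitInterval_rpow {s : ℝ} (hs : 0 ≤ s) :
    Continuous fun t : unitInterval => (t : ℝ) ^ s :=
  continuous_subtype_val.rpow_const fun _ => Or.inr hs

theorem integrable_unitInterval_rpow (μ : Measure unitInterval) [IsFiniteMeasure μ] {s : ℝ}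
    (hs : 0 ≤ s) : Integrable (fun t : unitInterval => (t : ℝ) ^ s) μ :=
  (continuous_unitInterval_rpow hs).integrable_of_hasCompactSupport
    (HasCompactSupport.of_compactSpace _)

namespace IsMomentFunction

theorem one : IsMomentFunction fun _ => 1 :=
  ⟨⟨Measure.dirac 1, inferInstance⟩, fun s _ => by simp⟩

theorem mul {f g : ℝ → ℝ} (hf : IsMomentFunction f) (hg : IsMomentFunction g) :
    IsMomentFunction fun s => f s * g s := by
  obtain ⟨μ, hμ⟩ := hf
  obtain ⟨ν, hν⟩ := hg
  refine ⟨⟨((μ : Measure unitInterval).prod (ν : Measure unitInterval)).map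
    fun p => p.1 * p.2, Measure.isProbabilityMeasure_map (by fun_prop)⟩, fun s hs => ?_⟩
  rw [ProbabilityMeasure.coe_mk, integral_map (by fun_prop)
    (continuous_unitInterval_rpow hs.le).aestronglyMeasurable]
  beta_reduce
  rw [hμ s hs, hν s hs, ← integral_prod_mul]
  refine integral_congr_ae (Eventually.of_forall fun p => ?_)
  exact (mul_rpow p.1.2.1 p.2.2.1).symm

theorem pow {f : ℝ → ℝ} (hf : IsMomentFunction f) (k : ℕ) :
    IsMomentFunction fun s => f s ^ k := by
  induction k with
  | zero => simpa using one
  | succ k ih => simpa only [pow_succ] using ih.mul hf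

theorem prod {ι : Type*} {f : ι → ℝ → ℝ} (I : Finset ι) (hf : ∀ i, IsMomentFunction (f i)) :
    IsMomentFunction fun s => ∏ i ∈ I, f i s := by
  classical
  induction I using Finset.induction_on with
  | empty => simpa using one
  | insert i I hi ih => simpa only [Finset.prod_insert hi] using (hf i).mul ih

theorem convexCombination {f g : ℝ → ℝ} (hf : IsMomentFunction f) (hg : IsMomentFunction g)
    {p q : ℝ} (hp : 0 ≤ p) (hq : 0 ≤ q) (hpq : p + q = 1) :
    IsMomentFunction fun s => p * f s + q * g s := by
  obtain ⟨μ, hμ⟩ := hf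
  obtain ⟨ν, hν⟩ := hg
  refine ⟨⟨ENNReal.ofReal p • (μ : Measure unitInterval) +
    ENNReal.ofReal q • (ν : Measure unitInterval), ⟨?_⟩⟩, fun s hs => ?_⟩
  · simp [← ENNReal.ofReal_add hp hq, hpq]
  · have h := fun (ρ : ProbabilityMeasure unitInterval) =>
      integrable_unitInterval_rpow (ρ : Measure unitInterval) hs.le
    rw [ProbabilityMeasure.coe_mk, integral_add_measure
      ((h μ).smul_measure ENNReal.ofReal_ne_top) ((h ν).smul_measure ENNReal.ofReal_ne_top),
      integral_smul_measure, integral_smul_measure, ENNReal.toReal_ofReal hp,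
      ENNReal.toReal_ofReal hq, ← hμ s hs, ← hν s hs, smul_eq_mul, smul_eq_mul]

/-- Moment functions are closed under pointwise limits, because the space of probability measures
on `[0, 1]` is compact. -/
theorem of_tendsto {F : ℕ → ℝ → ℝ} {f : ℝ → ℝ} (hF : ∀ N, IsMomentFunction (F N))
    (h : ∀ s, 0 < s → Tendsto (fun N => F N s) atTop (𝓝 (f s))) : IsMomentFunction f := by
  choose μ hμ using hF
  obtain ⟨ρ, hρ⟩ := exists_clusterPt_of_compactSpace (map μ atTop)
  obtain ⟨U, hU, hUρ⟩ := mapClusterPt_iff_ultrafilter.1 hρ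
  refine ⟨ρ, fun s hs => ?_⟩
  refine tendsto_nhds_unique ((h s hs).mono_left hU) ?_
  simp_rw [hμ _ s hs]
  exact ProbabilityMeasure.tendsto_iff_forall_integral_tendsto.1 hUρ
    (BoundedContinuousFunction.mkOfCompact ⟨_, continuous_unitInterval_rpow hs.le⟩)

/-- The law of `U ^ (1 / a)` with `U` uniform on `[0, 1]` has moment function `a / (s + a)`. -/
theorem div_add {a : ℝ} (ha : 0 < a) : IsMomentFunction fun s => a / (s + a) := by
  let r : unitInterval → unitInterval := fun t =>
    ⟨(t : ℝ) ^ a⁻¹, rpow_nonneg t.2.1 _, rpow_le_one t.2.1 t.2.2 (inv_nonneg.2 ha.le)⟩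
  have hr : Continuous r := (continuous_unitInterval_rpow (inv_nonneg.2 ha.le)).subtype_mk _
  refine ⟨⟨(volume : Measure unitInterval).map r,
    Measure.isProbabilityMeasure_map hr.aemeasurable⟩, fun s hs => ?_⟩
  rw [ProbabilityMeasure.coe_mk, integral_map hr.aemeasurable
    (continuous_unitInterval_rpow hs.le).aestronglyMeasurable]
  have h : ∀ t : unitInterval, ((r t : unitInterval) : ℝ) ^ s = (t : ℝ) ^ (a⁻¹ * s) :=
    fun t => (rpow_mul t.2.1 _ _).symm
  have hpos : 0 < a⁻¹ * s := by positivity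
  simp_rw [h]
  rw [Measure.Subtype.volume_def, integral_subtype_comap measurableSet_Icc (fun t : ℝ => t ^ (a⁻¹ * s)),
    integral_Icc_eq_integral_Ioc, ← intervalIntegral.integral_of_le zero_le_one,
    integral_rpow (Or.inl (by linarith)), one_rpow, zero_rpow (by linarith)]
  field_simp
  ring

theorem exp_sub_one {f : ℝ → ℝ} (hf : IsMomentFunction f) {b : ℝ} (hb : 0 ≤ b) :
    IsMomentFunction fun s => exp (b * (f s - 1)) := by
  obtain ⟨M, hM⟩ := exists_nat_ge b
  have hlim : ∀ s, Tendsto (fun N : ℕ => (1 + b * (f s - 1) / ((N + (M + 1) : ℕ) : ℝ)) ^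
      (N + (M + 1))) atTop (𝓝 (exp (b * (f s - 1)))) := fun s =>
    (tendsto_one_add_div_pow_exp _).comp (tendsto_add_atTop_nat _)
  refine of_tendsto (fun N => ?_) fun s _ => hlim s
  have hN : (0 : ℝ) < ((N + (M + 1) : ℕ) : ℝ) := by positivity
  have hbN : b / ((N + (M + 1) : ℕ) : ℝ) ≤ 1 := by
    rw [div_le_one hN]
    push_cast
    linarith [N.cast_nonneg (α := ℝ)]
  convert! (one.convexCombination hf (sub_nonneg.2 hbN) (div_nonneg hb hN.le)
    (by ring)).pow (N + (M + 1)) using 3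
  ring

end IsMomentFunction

/-- Euler's product for `sinh`. -/
theorem tendsto_prod_sinh_div {u : ℝ} (hu : 0 < u) :
    Tendsto (fun N : ℕ => ∏ j ∈ Finset.range N, (1 + 4 * u ^ 2 / ((j : ℝ) + 1) ^ 2)) atTop
      (𝓝 (sinh (2 * π * u) / (2 * π * u))) := by
  have hz : (2 * u * Complex.I : ℂ) ≠ 0 := by simp [hu.ne']
  have h := tendsto_euler_sin_prod' hz
  rw [← tendsto_ofReal_iff]
  convert! h using 2 with N
  · push_cast
    refine Finset.prod_congr rfl fun j _ => ?_
    simp only [sineTerm, mul_pow, Complex.I_sq]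
    ring
  · have : (π * (2 * u * Complex.I) : ℂ) = ((2 * π * u : ℝ) : ℂ) * Complex.I := by
      push_cast; ring
    rw [this, Complex.sin_mul_I, mul_div_mul_right _ _ Complex.I_ne_zero]
    push_cast
    rfl

/-- The partial fraction expansion of `coth`. -/
theorem tendsto_sum_coth {u : ℝ} (hu : 0 < u) :
    Tendsto (fun N : ℕ => ∑ j ∈ Finset.range N, 4 * u ^ 2 / (4 * u ^ 2 + ((j : ℝ) + 1) ^ 2)) atTop
      (𝓝 ((2 * π * u * (cosh (2 * π * u) / sinh (2 * π * u)) - 1) / 2)) := by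
  have hz : (2 * u * Complex.I : ℂ) ∈ Complex.integerComplement := by
    rintro ⟨k, hk⟩
    have := congrArg Complex.im hk
    simp at this
    linarith
  have h := (tendsto_logDeriv_euler_cot_sub hz).mul_const (u * Complex.I : ℂ)
  rw [← tendsto_ofReal_iff]
  convert! h using 2 with N
  · rw [Finset.sum_mul]
    push_cast
    refine Finset.sum_congr rfl fun j _ => ?_
    rw [cotTerm_identity hz]
    have hden : (2 * u * Complex.I + (j + 1)) * (2 * u * Complex.I - (j + 1)) =
        -(4 * u ^ 2 + ((j : ℂ) + 1) ^ 2) := by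
      linear_combination 4 * (u : ℂ) ^ 2 * Complex.I_sq
    rw [hden, one_div, inv_neg]
    linear_combination
      (4 * (u : ℂ) ^ 2 * (4 * (u : ℂ) ^ 2 + ((j : ℂ) + 1) ^ 2)⁻¹) * Complex.I_sq
  · have : (π * (2 * u * Complex.I) : ℂ) = ((2 * π * u : ℝ) : ℂ) * Complex.I := by
      push_cast; ring
    rw [this, Complex.cot, Complex.sin_mul_I, Complex.cos_mul_I]
    have hsinh : Complex.sinh ((2 * π * u : ℝ) : ℂ) ≠ 0 := by
      exact_mod_cast (sinh_pos_iff.2 (by positivity)).ne'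
    have hu' : (u : ℂ) ≠ 0 := by exact_mod_cast hu.ne'
    simp only [Complex.ofReal_sub, Complex.ofReal_div, Complex.ofReal_mul, Complex.ofReal_cosh,
      Complex.ofReal_sinh, Complex.ofReal_one, Complex.ofReal_ofNat] at hsinh ⊢
    field_simp

theorem div_sinh_le {x : ℝ} (hx : 0 < x) : x / sinh x ≤ (1 + x ^ 2 / 8)⁻¹ := by
  have h1 : x / 2 ≤ sinh (x / 2) := self_le_sinh_iff.2 (by positivity)
  have h2 : 1 + x ^ 2 / 8 ≤ cosh (x / 2) := by
    have h := cosh_sq (x / 4)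
    have h' := cosh_two_mul (x / 4)
    have h3 : x / 4 ≤ sinh (x / 4) := self_le_sinh_iff.2 (by positivity)
    rw [show 2 * (x / 4) = x / 2 by ring] at h'
    nlinarith
  have h3 := sinh_two_mul (x / 2)
  rw [mul_div_cancel₀ x two_ne_zero] at h3
  have h4 : x / 2 * (1 + x ^ 2 / 8) ≤ sinh (x / 2) * cosh (x / 2) :=
    mul_le_mul h1 h2 (by positivity) (by linarith)
  rw [inv_eq_one_div, div_le_div_iff₀ (sinh_pos_iff.2 hx) (by positivity)]
  linarith

theorem isMomentFunction_exp_coth_mul_div_sinh_pow (n : ℕ) {b : ℝ} (hb : 0 ≤ b) :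
    IsMomentFunction fun s =>
      exp (-b * (2 * π * √s * (cosh (2 * π * √s) / sinh (2 * π * √s)) - 1)) *
        (2 * π * √s / sinh (2 * π * √s)) ^ n := by
  have ha : ∀ j : ℕ, IsMomentFunction
      fun s => ((j : ℝ) + 1) ^ 2 / 4 / (s + ((j : ℝ) + 1) ^ 2 / 4) :=
    fun j => IsMomentFunction.div_add (by positivity)
  refine IsMomentFunction.of_tendsto (fun N =>
    (IsMomentFunction.prod (Finset.range N) fun j =>
      (ha j).exp_sub_one (b := 2 * b) (by positivity)).mul
    ((IsMomentFunction.prod (Finset.range N) ha).pow n)) fun s hs => ?_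
  have hu : 0 < √s := sqrt_pos.2 hs
  have hsinh : sinh (2 * π * √s) ≠ 0 := (sinh_pos_iff.2 (by positivity)).ne'
  refine Tendsto.mul ?_ (Tendsto.pow ?_ n)
  · simp_rw [← exp_sum]
    refine (continuous_exp.tendsto _).comp ?_
    convert! (tendsto_sum_coth hu).const_mul (-(2 * b)) using 2 with N
    · rw [Finset.mul_sum]
      refine Finset.sum_congr rfl fun j _ => ?_
      rw [sq_sqrt hs.le]
      field_simp
      ring
    · ring
  · convert! (tendsto_prod_sinh_div hu).inv₀ (div_ne_zero hsinh (by positivity)) using 2 with N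
    · rw [← Finset.prod_inv_distrib]
      refine Finset.prod_congr rfl fun j _ => ?_
      rw [sq_sqrt hs.le]
      field_simp
      ring
    · rw [inv_div]

/-- If `u ↦ φ u` is a multiple of a moment function of `u ^ 2` and decays like `(1 + u ^ 2)⁻¹`, it
is an average of Gaussians; the substitution is `t = exp (-π * τ ^ 2)`, and the decay excludes mass
at `t = 1` and bounds `∫ τ⁻¹`. -/
theorem exists_gaussian_mixture {f φ : ℝ → ℝ} (hf : IsMomentFunction f) {C K : ℝ} (hC : 0 < C)
    (hφ : ∀ u, 0 < u → φ u = C * f (u ^ 2)) (hK : ∀ u, 0 < u → φ u ≤ K * (1 + u ^ 2)⁻¹) :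
    ∃ ν : Measure ℝ, IsFiniteMeasure ν ∧ ν (Set.Ioi 0)ᶜ = 0 ∧
      (∫⁻ τ in Set.Ioi (0 : ℝ), ENNReal.ofReal τ⁻¹ ∂ν) < ⊤ ∧
      ∀ u ∈ Set.Ioi (0 : ℝ),
        φ u = ∫ τ in Set.Ioi (0 : ℝ), Real.exp (-π * τ ^ 2 * u ^ 2) ∂ν := by
  obtain ⟨⟨μ, hprob⟩, hμ⟩ := hf
  simp only [ProbabilityMeasure.coe_mk] at hμ
  have hφμ : ∀ u, 0 < u → φ u = C * ∫ t, (t : ℝ) ^ (u ^ 2) ∂μ := fun u hu => by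
    rw [hφ u hu, hμ _ (by positivity)]
  have hone : μ {1} = 0 := by
    have hle : ∀ u, 0 < u → C * μ.real {1} ≤ K * (1 + u ^ 2)⁻¹ := fun u hu => by
      refine le_trans ?_ (hK u hu)
      rw [hφμ u hu]
      gcongr
      calc μ.real {1} = ∫ t in ({1} : Set unitInterval), (t : ℝ) ^ (u ^ 2) ∂μ := by
            simp [Measure.real]
        _ ≤ _ := setIntegral_le_integral (integrable_unitInterval_rpow μ (sq_nonneg u))
            (Eventually.of_forall fun t => rpow_nonneg t.2.1 _)
    have hlim : Tendsto (fun u : ℝ => K * (1 + u ^ 2)⁻¹) atTop (𝓝 (K * 0)) :=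
      (tendsto_inv_atTop_zero.comp (tendsto_atTop_add_const_left _ 1
        (tendsto_pow_atTop two_ne_zero))).const_mul K
    rw [mul_zero] at hlim
    have h0 : C * μ.real {1} ≤ 0 := ge_of_tendsto hlim ((eventually_gt_atTop 0).mono hle)
    have : μ.real {1} = 0 := le_antisymm (by nlinarith [measureReal_nonneg (μ := μ) (s := {1})])
      measureReal_nonneg
    simpa [measureReal_eq_zero_iff] using this
  let S : Set unitInterval := {t | 0 < (t : ℝ) ∧ (t : ℝ) < 1}
  have hS : MeasurableSet S :=
    (measurableSet_lt measurable_const measurable_subtype_coe).inter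
      (measurableSet_lt measurable_subtype_coe measurable_const)
  let T : unitInterval → ℝ := fun t => √(-log t / π)
  have hT : Measurable T :=
    (((measurable_log.comp measurable_subtype_coe).neg).div_const π).sqrt
  let ν : Measure ℝ := ENNReal.ofReal C • (μ.restrict S).map T
  have hν : IsFiniteMeasure ν := by
    have := Measure.isFiniteMeasure_map (μ.restrict S) T
    exact Measure.smul_finite _ ENNReal.ofReal_ne_top
  have hnull : ν (Set.Ioi 0)ᶜ = 0 := by
    have : (T ⁻¹' (Set.Ioi 0)ᶜ) ∩ S = ∅ := by
      ext t
      simp only [mem_inter_iff, mem_preimage, mem_compl_iff, mem_Ioi, mem_empty_iff_false,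
        iff_false, not_and]
      exact fun h hS => h (sqrt_pos.2 (div_pos (neg_pos.2 (log_neg hS.1 hS.2)) pi_pos))
    simp only [ν, Measure.smul_apply]
    rw [Measure.map_apply hT measurableSet_Ioi.compl,
      Measure.restrict_apply (hT measurableSet_Ioi.compl), this]
    simp
  have hrestrict : ν.restrict (Set.Ioi 0) = ν :=
    Measure.restrict_eq_self_of_ae_mem (measure_eq_zero_iff_ae_notMem.1 hnull |>.mono
      fun τ hτ => not_not.1 hτ)
  have hint : ∀ u ∈ Set.Ioi (0 : ℝ),
      φ u = ∫ τ in Set.Ioi (0 : ℝ), Real.exp (-π * τ ^ 2 * u ^ 2) ∂ν := fun u hu => by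
    rw [hrestrict, integral_smul_measure, ENNReal.toReal_ofReal hC.le, smul_eq_mul,
      integral_map hT.aemeasurable (by fun_prop), hφμ u hu]
    congr 1
    have hae : ∀ᵐ t ∂μ, t ∉ S → (t : ℝ) ^ (u ^ 2) = 0 := by
      filter_upwards [measure_eq_zero_iff_ae_notMem.1 hone] with t ht htS
      have ht0 : (t : ℝ) = 0 := by
        by_contra h
        exact htS ⟨lt_of_le_of_ne t.2.1 (Ne.symm h),
          lt_of_le_of_ne t.2.2 fun h1 => ht (Subtype.ext h1)⟩
      rw [ht0, zero_rpow (pow_pos hu 2).ne']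
    rw [← setIntegral_eq_integral_of_ae_compl_eq_zero hae]
    refine setIntegral_congr_fun hS fun t ht => ?_
    have hlog : 0 ≤ -log (t : ℝ) / π :=
      div_nonneg (neg_nonneg.2 (log_nonpos ht.1.le ht.2.le)) pi_pos.le
    simp only [T]
    rw [sq_sqrt hlog, rpow_def_of_pos ht.1]
    field_simp
  refine ⟨ν, hν, hnull, ?_, hint⟩
  have hgauss : ∀ τ ∈ Set.Ioi (0 : ℝ), ENNReal.ofReal τ⁻¹ =
      2 * ∫⁻ u in Set.Ioi (0 : ℝ), ENNReal.ofReal (exp (-π * τ ^ 2 * u ^ 2)) := fun τ hτ => by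
    have hτ' : 0 < τ := hτ
    have hb : 0 < π * τ ^ 2 := by positivity
    rw [← ofReal_integral_eq_lintegral_ofReal (by
        simpa only [neg_mul, IntegrableOn] using
          (integrable_exp_neg_mul_sq hb).integrableOn (s := Set.Ioi 0))
        (Eventually.of_forall fun u => (exp_pos _).le),
      neg_mul, integral_gaussian_Ioi, ← ENNReal.ofReal_ofNat 2,
      ← ENNReal.ofReal_mul zero_le_two]
    congr 1
    rw [div_mul_cancel_left₀ pi_pos.ne', sqrt_inv, sqrt_sq hτ'.le]
    ring
  calc ∫⁻ τ in Set.Ioi (0 : ℝ), ENNReal.ofReal τ⁻¹ ∂ν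
      = ∫⁻ τ in Set.Ioi (0 : ℝ),
          (2 * ∫⁻ u in Set.Ioi (0 : ℝ), ENNReal.ofReal (exp (-π * τ ^ 2 * u ^ 2))) ∂ν :=
        setLIntegral_congr_fun measurableSet_Ioi hgauss
    _ = 2 * ∫⁻ u in Set.Ioi (0 : ℝ), ∫⁻ τ in Set.Ioi (0 : ℝ),
          ENNReal.ofReal (exp (-π * τ ^ 2 * u ^ 2)) ∂ν := by
        rw [lintegral_const_mul' _ _ ENNReal.ofNat_ne_top, lintegral_lintegral_swap]
        exact Measurable.aemeasurable (by fun_prop)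
    _ ≤ 2 * ∫⁻ u in Set.Ioi (0 : ℝ), ENNReal.ofReal (K * (1 + u ^ 2)⁻¹) := by
        gcongr 2 * ?_
        refine setLIntegral_mono' measurableSet_Ioi fun u hu => ?_
        rw [← ofReal_integral_eq_lintegral_ofReal _ (Eventually.of_forall fun τ => (exp_pos _).le),
          ← hint u hu]
        · exact ENNReal.ofReal_le_ofReal (hK u hu)
        · refine Integrable.of_bound (by fun_prop) 1 (Eventually.of_forall fun τ => ?_)
          rw [norm_of_nonneg (exp_pos _).le, exp_le_one_iff, neg_mul, neg_mul]
          exact neg_nonpos.2 (by positivity)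
    _ < ⊤ := ENNReal.mul_lt_top ENNReal.ofNat_lt_top
        ((integrable_inv_one_add_sq.const_mul K).integrableOn.lintegral_lt_top)

/-- Fix an integer `n ≥ 1` and a real `c ≥ 0`, and define `φ : (0, ∞) → ℝ` by
`φ u = exp (-(π/2) * c * u * coth (2πu)) * (u / (4π * sinh (2πu)))ⁿ`.
There exists a finite nonnegative Borel measure `ν` on `(0, ∞)` with
`∫₀^∞ τ⁻¹ dν(τ) < ∞` such that, for every `u > 0`,
`φ u = ∫₀^∞ exp (-π * τ² * u²) dν(τ)`: `φ` is an average of Gaussians. -/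
theorem stmt_13 (n : ℕ) (hn : 1 ≤ n) (c : ℝ) (hc : 0 ≤ c) (φ : ℝ → ℝ)
    (hφ : ∀ u ∈ Set.Ioi (0 : ℝ),
      φ u = Real.exp (-(π / 2) * c * u * (Real.cosh (2 * π * u) / Real.sinh (2 * π * u)))
        * (u / (4 * π * Real.sinh (2 * π * u))) ^ n) :
    ∃ ν : Measure ℝ, IsFiniteMeasure ν ∧ ν (Set.Ioi 0)ᶜ = 0 ∧
      (∫⁻ τ in Set.Ioi (0 : ℝ), ENNReal.ofReal τ⁻¹ ∂ν) < ⊤ ∧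
      ∀ u ∈ Set.Ioi (0 : ℝ),
        φ u = ∫ τ in Set.Ioi (0 : ℝ), Real.exp (-π * τ ^ 2 * u ^ 2) ∂ν := by
  have hsinh : ∀ u, 0 < u → 0 < sinh (2 * π * u) := fun u hu => sinh_pos_iff.2 (by positivity)
  have hsplit : ∀ u, 0 < u → u / (4 * π * sinh (2 * π * u)) =
      (8 * π ^ 2)⁻¹ * (2 * π * u / sinh (2 * π * u)) := fun u hu => by
    have := (hsinh u hu).ne'
    field_simp
    norm_num
  refine exists_gaussian_mixture (C := exp (-(c / 4)) * (8 * π ^ 2)⁻¹ ^ n)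
    (K := (8 * π ^ 2)⁻¹ ^ n)
    (isMomentFunction_exp_coth_mul_div_sinh_pow n (b := c / 4) (by positivity)) (by positivity)
    (fun u hu => ?_) fun u hu => ?_
  · rw [hφ u hu, hsplit u hu, sqrt_sq hu.le, mul_pow, mul_mul_mul_comm, ← exp_add]
    congr 2
    ring
  · have hs := hsinh u hu
    have hle : 2 * π * u / sinh (2 * π * u) ≤ (1 + u ^ 2)⁻¹ := by
      refine (div_sinh_le (by positivity)).trans (inv_anti₀ (by positivity) ?_)
      have : 3 * 3 ≤ π * π := mul_self_le_mul_self (by norm_num) pi_gt_three.le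
      nlinarith [mul_le_mul_of_nonneg_right this (sq_nonneg u)]
    have hpow : (2 * π * u / sinh (2 * π * u)) ^ n ≤ (1 + u ^ 2)⁻¹ :=
      (pow_le_of_le_one (by positivity)
        (hle.trans (inv_le_one_of_one_le₀ (by nlinarith))) (by lia)).trans hle
    have hexp : exp (-(π / 2) * c * u * (cosh (2 * π * u) / sinh (2 * π * u))) ≤ 1 := by
      rw [exp_le_one_iff, neg_mul, neg_mul, neg_mul]
      have := cosh_pos (2 * π * u)
      exact neg_nonpos.2 (by positivity)
    rw [hφ u hu, hsplit u hu, mul_pow]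
    refine (mul_le_of_le_one_left (by positivity) hexp).trans ?_
    gcongr
end
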